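/- Let L > 0 and m ≥ 1. For all smooth L-periodic functions f, g : ℝ² → ℝ, the operator Q_m is self-adjoint with respect to the L² inner product on [0,L]²: ∫_{[0,L]²} (Q_m f) g dμ = ∫_{[0,L]²} f (Q_m g) dμ. -/

import Mathlib

open MeasureTheory

/-- Partial derivative in the `x` direction. -/
noncomputable def px (f : ℝ × ℝ → ℝ) : ℝ × ℝ → ℝ := fun p => fderiv ℝ f p (1, 0)

/-- Partial derivative in the `y` direction. -/
noncomputable def py (f : ℝ × ℝ → ℝ) : ℝ × ℝ → ℝ := fun p => fderiv ℝ f p (0, 1)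

/-- The Laplacian `Δf = f_xx + f_yy`. -/
noncomputable def lap (f : ℝ × ℝ → ℝ) : ℝ × ℝ → ℝ := fun p => px (px f) p + py (py f) p

/-- `D^α = ∂_x^{α₁} ∂_y^{α₂}` for a bi-index `α`. -/
noncomputable def Dop (α : ℕ × ℕ) (f : ℝ × ℝ → ℝ) : ℝ × ℝ → ℝ := px^[α.1] (py^[α.2] f)

/-- The differential operators `Q_m`, defined recursively by `Q₁ = 0` and
`Q_m f = Q_{m−1}((I−Δ)f) − Σ_{|α| ≤ m−2} (−1)^{|α|} D^α D^α Δf` for `m ≥ 2`. -/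
noncomputable def Q : ℕ → (ℝ × ℝ → ℝ) → (ℝ × ℝ → ℝ)
  | 0, _ => 0
  | 1, _ => 0
  | (m + 2), f =>
      Q (m + 1) (fun p => f p - lap f p) -
        fun p =>
          ∑ α ∈ (Finset.range (m + 1) ×ˢ Finset.range (m + 1)).filter
              (fun α : ℕ × ℕ => α.1 + α.2 ≤ m),
            (-1 : ℝ) ^ (α.1 + α.2) * Dop α (Dop α (lap f)) p

/-- `f` is `L`-periodic in both variables. -/
def IsPeriodic (L : ℝ) (f : ℝ × ℝ → ℝ) : Prop :=
  ∀ x y : ℝ, f (x + L, y) = f (x, y) ∧ f (x, y + L) = f (x, y)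

theorem IsPeriodic.add_left {L : ℝ} {f : ℝ × ℝ → ℝ} (hf : IsPeriodic L f) (p : ℝ × ℝ) :
    f (p + (L, 0)) = f p := by
  simpa [Prod.add_def] using (hf p.1 p.2).1

theorem IsPeriodic.add_right {L : ℝ} {f : ℝ × ℝ → ℝ} (hf : IsPeriodic L f) (p : ℝ × ℝ) :
    f (p + (0, L)) = f p := by
  simpa [Prod.add_def] using (hf p.1 p.2).2

theorem IsPeriodic.fderiv_apply {L : ℝ} {f : ℝ × ℝ → ℝ} (hf : IsPeriodic L f) (v : ℝ × ℝ) :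
    IsPeriodic L (fun p => fderiv ℝ f p v) := by
  intro x y
  constructor
  · have h := fderiv_comp_add_right (𝕜 := ℝ) (f := f) (x := (x, y)) (L, 0)
    simp only [hf.add_left] at h
    simp [h]
  · have h := fderiv_comp_add_right (𝕜 := ℝ) (f := f) (x := (x, y)) (0, L)
    simp only [hf.add_right] at h
    simp [h]

/-- The space of smooth `L`-periodic functions on the plane. -/
def smoothPeriodic (L : ℝ) : Submodule ℝ (ℝ × ℝ → ℝ) where
  carrier := {f | ContDiff ℝ (⊤ : ℕ∞) f ∧ IsPeriodic L f}
  zero_mem' := ⟨contDiff_const, fun _ _ => ⟨rfl, rfl⟩⟩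
  add_mem' hf hg := ⟨hf.1.add hg.1, fun x y => by
    simp only [Pi.add_apply, (hf.2 x y).1, (hf.2 x y).2, (hg.2 x y).1, (hg.2 x y).2, and_self]⟩
  smul_mem' c _ hf := ⟨contDiff_const.smul hf.1, fun x y => by
    simp only [Pi.smul_apply, (hf.2 x y).1, (hf.2 x y).2, and_self]⟩

namespace smoothPeriodic

variable {L : ℝ}

theorem contDiff (f : smoothPeriodic L) : ContDiff ℝ (⊤ : ℕ∞) (f : ℝ × ℝ → ℝ) := f.2.1

theorem isPeriodic (f : smoothPeriodic L) : IsPeriodic L (f : ℝ × ℝ → ℝ) := f.2.2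

theorem differentiable (f : smoothPeriodic L) : Differentiable ℝ (f : ℝ × ℝ → ℝ) :=
  (contDiff f).differentiable (by simp)

theorem continuous (f : smoothPeriodic L) : Continuous (f : ℝ × ℝ → ℝ) := (contDiff f).continuous

/-- The directional derivative along `v`, as an endomorphism of the smooth periodic functions. -/
noncomputable def dirDeriv (L : ℝ) (v : ℝ × ℝ) : Module.End ℝ (smoothPeriodic L) where
  toFun f := ⟨fun p => fderiv ℝ f p v,
    ((contDiff f).fderiv_right (m := (⊤ : ℕ∞)) (by simp)).clm_apply contDiff_const,
    (isPeriodic f).fderiv_apply v⟩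
  map_add' f g := by
    ext p
    simp [fderiv_add (differentiable f p) (differentiable g p)]
  map_smul' c f := by
    ext p
    simp [fderiv_const_smul (differentiable f p)]

@[simp]
theorem coe_dirDeriv (v : ℝ × ℝ) (f : smoothPeriodic L) :
    (dirDeriv L v f : ℝ × ℝ → ℝ) = fun p => fderiv ℝ f p v := rfl

theorem dirDeriv_commute (v w : ℝ × ℝ) : Commute (dirDeriv L v) (dirDeriv L w) := by
  ext f p
  have hd : DifferentiableAt ℝ (fderiv ℝ (f : ℝ × ℝ → ℝ)) p :=
    ((contDiff f).fderiv_right (m := (⊤ : ℕ∞)) (by simp)).differentiable (by simp) p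
  have hs : IsSymmSndFDerivAt ℝ (f : ℝ × ℝ → ℝ) p :=
    (contDiff f).contDiffAt.isSymmSndFDerivAt
      (by simpa using WithTop.coe_le_coe.2 (le_top : (2 : ℕ∞) ≤ ⊤))
  simp [fderiv_clm_apply hd (differentiableAt_const _), hs.eq v w]

theorem integrableOn_mul (f g : smoothPeriodic L) :
    IntegrableOn (fun p => (f : ℝ × ℝ → ℝ) p * (g : ℝ × ℝ → ℝ) p)
      (Set.Icc (0 : ℝ) L ×ˢ Set.Icc (0 : ℝ) L) :=
  ((continuous f).mul (continuous g)).continuousOn.integrableOn_compact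
    (isCompact_Icc.prod isCompact_Icc)

/-- The `L²` inner product over a period square. -/
noncomputable def l2Form (L : ℝ) : LinearMap.BilinForm ℝ (smoothPeriodic L) :=
  LinearMap.mk₂ ℝ
    (fun f g => ∫ p in Set.Icc (0 : ℝ) L ×ˢ Set.Icc (0 : ℝ) L,
      (f : ℝ × ℝ → ℝ) p * (g : ℝ × ℝ → ℝ) p)
    (fun f g h => by
      rw [← integral_add (integrableOn_mul f h) (integrableOn_mul g h)]
      simp [add_mul])
    (fun c f g => by simp [mul_assoc, integral_const_mul])
    (fun f g h => by
      rw [← integral_add (integrableOn_mul f g) (integrableOn_mul f h)]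
      simp [mul_add])
    (fun c f g => by simp [mul_left_comm, integral_const_mul])

theorem l2Form_apply (f g : smoothPeriodic L) :
    l2Form L f g = ∫ p in Set.Icc (0 : ℝ) L ×ˢ Set.Icc (0 : ℝ) L,
      (f : ℝ × ℝ → ℝ) p * (g : ℝ × ℝ → ℝ) p := rfl

/-- The integral of the derivative of a smooth periodic function over a period vanishes. -/
theorem integral_dirDeriv (hL : 0 ≤ L) (v : ℝ × ℝ) (h : smoothPeriodic L) :
    ∫ p in Set.Icc (0 : ℝ) L ×ˢ Set.Icc (0 : ℝ) L, fderiv ℝ (h : ℝ × ℝ → ℝ) p v = 0 := by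
  have hv (p : ℝ × ℝ) : fderiv ℝ (h : ℝ × ℝ → ℝ) p v
      = (v.1 • fderiv ℝ (h : ℝ × ℝ → ℝ) p) (1, 0) + (v.2 • fderiv ℝ (h : ℝ × ℝ → ℝ) p) (0, 1) := by
    rw [smul_apply, smul_apply, ← map_smul, ← map_smul,
      ← map_add]
    simp
  have hc (c : ℝ) : ContinuousOn (fun p => c • (h : ℝ × ℝ → ℝ) p) (Set.Icc (0, 0) (L, L)) :=
    ((continuous h).const_smul c).continuousOn
  have hd (c : ℝ) (p : ℝ × ℝ) : HasFDerivAt (fun p => c • (h : ℝ × ℝ → ℝ) p)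
      (c • fderiv ℝ (h : ℝ × ℝ → ℝ) p) p := (differentiable h p).hasFDerivAt.const_smul c
  have hi : IntegrableOn (fun p => fderiv ℝ (h : ℝ × ℝ → ℝ) p v) (Set.Icc (0, 0) (L, L)) :=
    (continuous (dirDeriv L v h)).continuousOn.integrableOn_compact isCompact_Icc
  simp only [hv] at hi ⊢
  rw [Set.Icc_prod_Icc, integral_divergence_prod_Icc_of_hasFDerivAt_of_le _ _ _ _ _ _
    (Prod.mk_le_mk.2 ⟨hL, hL⟩) (hc v.1) (hc v.2) (fun p _ => hd v.1 p) (fun p _ => hd v.2 p) hi]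
  have h1 (y : ℝ) : (h : ℝ × ℝ → ℝ) (L, y) = (h : ℝ × ℝ → ℝ) (0, y) := by
    simpa using (isPeriodic h 0 y).1
  have h2 (x : ℝ) : (h : ℝ × ℝ → ℝ) (x, L) = (h : ℝ × ℝ → ℝ) (x, 0) := by
    simpa using (isPeriodic h x 0).2
  simp [h1, h2]

/-- Integration by parts: directional derivatives are skew-adjoint. -/
theorem isAdjointPair_dirDeriv (hL : 0 ≤ L) (v : ℝ × ℝ) :
    LinearMap.IsAdjointPair (l2Form L) (l2Form L) (dirDeriv L v) (-dirDeriv L v) := by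
  intro f g
  let h : smoothPeriodic L := ⟨fun p => (f : ℝ × ℝ → ℝ) p * (g : ℝ × ℝ → ℝ) p,
    (contDiff f).mul (contDiff g), fun x y => by
      simp only [(isPeriodic f x y).1, (isPeriodic f x y).2, (isPeriodic g x y).1,
        (isPeriodic g x y).2, and_self]⟩
  have hh (p : ℝ × ℝ) : fderiv ℝ (h : ℝ × ℝ → ℝ) p v
      = (dirDeriv L v f : ℝ × ℝ → ℝ) p * (g : ℝ × ℝ → ℝ) p
        + (f : ℝ × ℝ → ℝ) p * (dirDeriv L v g : ℝ × ℝ → ℝ) p := by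
    simp [h, fderiv_fun_mul (differentiable f p) (differentiable g p)]
    ring
  have h0 := integral_dirDeriv hL v h
  simp only [hh] at h0
  rw [integral_add (integrableOn_mul _ _) (integrableOn_mul _ _), ← l2Form_apply,
    ← l2Form_apply] at h0
  rw [Pi.neg_apply, map_neg]
  linarith

theorem isAdjointPair_dirDeriv_sq (hL : 0 ≤ L) (v : ℝ × ℝ) :
    LinearMap.IsAdjointPair (l2Form L) (l2Form L)
      (dirDeriv L v ^ 2 : Module.End ℝ (smoothPeriodic L))
      (dirDeriv L v ^ 2 : Module.End ℝ (smoothPeriodic L)) := by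
  intro f g
  have h := isAdjointPair_dirDeriv hL v
  simp only [pow_two, Module.End.mul_apply, h _ _, Pi.neg_apply, map_neg, neg_neg]

/-- The algebra of differential operators generated by `∂ₓ²` and `∂ᵧ²`. -/
noncomputable def evenOps (L : ℝ) : Subalgebra ℝ (Module.End ℝ (smoothPeriodic L)) :=
  Algebra.adjoin ℝ {dirDeriv L (1, 0) ^ 2, dirDeriv L (0, 1) ^ 2}

theorem evenOps_commute {S T : Module.End ℝ (smoothPeriodic L)} (hS : S ∈ evenOps L)
    (hT : T ∈ evenOps L) : Commute S T := by
  refine Algebra.commute_of_mem_adjoin_of_forall_mem_commute hT fun b hb => .symm ?_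
  refine Algebra.commute_of_mem_adjoin_of_forall_mem_commute hS fun a ha => ?_
  rcases hb with rfl | rfl <;> rcases ha with rfl | rfl <;>
    exact (dirDeriv_commute _ _).pow_pow _ _

theorem isAdjointPair_of_mem_evenOps (hL : 0 ≤ L) {T : Module.End ℝ (smoothPeriodic L)}
    (hT : T ∈ evenOps L) : LinearMap.IsAdjointPair (l2Form L) (l2Form L) T T := by
  induction hT using Algebra.adjoin_induction with
  | mem T hT => rcases hT with rfl | rfl <;> exact isAdjointPair_dirDeriv_sq hL _
  | algebraMap r => intro f g; simp [Module.algebraMap_end_apply]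
  | add S T _ _ hS hT => exact hS.add hT
  | mul S T hS hT hS' hT' =>
    have h := hS'.mul hT'
    rwa [← (evenOps_commute hS hT).eq] at h

/-- The Laplacian on smooth periodic functions. -/
noncomputable def laplacian (L : ℝ) : Module.End ℝ (smoothPeriodic L) :=
  dirDeriv L (1, 0) ^ 2 + dirDeriv L (0, 1) ^ 2

theorem coe_laplacian (f : smoothPeriodic L) : (laplacian L f : ℝ × ℝ → ℝ) = lap f := by
  rw [laplacian, pow_two, pow_two]
  rfl

theorem coe_dirDeriv_pow_mul (α : ℕ × ℕ) (f : smoothPeriodic L) :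
    ((dirDeriv L (1, 0) ^ α.1 * dirDeriv L (0, 1) ^ α.2) f : smoothPeriodic L) = Dop α f := by
  have hx (g : smoothPeriodic L) (n : ℕ) :
      ((dirDeriv L (1, 0) ^ n) g : ℝ × ℝ → ℝ) = px^[n] g := by
    induction n with
    | zero => rfl
    | succ n ih => rw [pow_succ', Function.iterate_succ_apply', ← ih]; rfl
  have hy (g : smoothPeriodic L) (n : ℕ) :
      ((dirDeriv L (0, 1) ^ n) g : ℝ × ℝ → ℝ) = py^[n] g := by
    induction n with
    | zero => rfl
    | succ n ih => rw [pow_succ', Function.iterate_succ_apply', ← ih]; rfl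
  rw [Module.End.mul_apply, hx, hy, Dop]

theorem dirDeriv_pow_mul_sq_mem_evenOps (a b : ℕ) :
    (dirDeriv L (1, 0) ^ a * dirDeriv L (0, 1) ^ b) *
      (dirDeriv L (1, 0) ^ a * dirDeriv L (0, 1) ^ b) ∈ evenOps L := by
  rw [← pow_two, ((dirDeriv_commute _ _).pow_pow a b).mul_pow, ← pow_mul, ← pow_mul, mul_comm a,
    mul_comm b, pow_mul, pow_mul]
  exact mul_mem (pow_mem (Algebra.subset_adjoin (by simp)) _)
    (pow_mem (Algebra.subset_adjoin (by simp)) _)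

/-- On smooth periodic functions, `Q m` acts as an element of `evenOps L`. -/
theorem exists_mem_evenOps_eq_Q (L : ℝ) (m : ℕ) :
    ∃ T ∈ evenOps L, ∀ f : smoothPeriodic L, (T f : ℝ × ℝ → ℝ) = Q m f := by
  induction m with
  | zero => exact ⟨0, zero_mem _, fun f => by simp [Q]⟩
  | succ m ih =>
    rcases m with - | m
    · exact ⟨0, zero_mem _, fun f => by simp [Q]⟩
    obtain ⟨T, hT, hTQ⟩ := ih
    have hlap : laplacian L ∈ evenOps L :=
      add_mem (Algebra.subset_adjoin (by simp)) (Algebra.subset_adjoin (by simp))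
    let S (α : ℕ × ℕ) : Module.End ℝ (smoothPeriodic L) :=
      (-1 : ℝ) ^ (α.1 + α.2) •
        ((dirDeriv L (1, 0) ^ α.1 * dirDeriv L (0, 1) ^ α.2) *
          (dirDeriv L (1, 0) ^ α.1 * dirDeriv L (0, 1) ^ α.2) * laplacian L)
    have hS (α : ℕ × ℕ) : S α ∈ evenOps L := Subalgebra.smul_mem _
      (Subalgebra.mul_mem _ (dirDeriv_pow_mul_sq_mem_evenOps α.1 α.2) hlap) _
    have hsum : ∑ α ∈ (Finset.range (m + 1) ×ˢ Finset.range (m + 1)).filter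
        (fun α : ℕ × ℕ => α.1 + α.2 ≤ m), S α ∈ evenOps L := sum_mem fun α _ => hS α
    refine ⟨_, add_mem (mul_mem hT (add_mem (one_mem _) (Subalgebra.smul_mem _ hlap (-1))))
      (Subalgebra.smul_mem _ hsum (-1)), fun f => ?_⟩
    have h1 : ((f - laplacian L f : smoothPeriodic L) : ℝ × ℝ → ℝ)
        = fun p => (f : ℝ × ℝ → ℝ) p - lap f p := by
      rw [← coe_laplacian]; rfl
    have h2 (α : ℕ × ℕ) : Dop α (Dop α (lap f)) =
        (((dirDeriv L (1, 0) ^ α.1 * dirDeriv L (0, 1) ^ α.2) *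
            (dirDeriv L (1, 0) ^ α.1 * dirDeriv L (0, 1) ^ α.2) * laplacian L) f :
          smoothPeriodic L) := by
      rw [← coe_laplacian, ← coe_dirDeriv_pow_mul, ← coe_dirDeriv_pow_mul]; rfl
    rw [Q, ← h1, ← hTQ]
    ext p
    simp only [h2, S, LinearMap.add_apply, LinearMap.sum_apply, LinearMap.smul_apply, neg_smul,
      one_smul, Submodule.coe_sub, Submodule.coe_sum, Submodule.coe_smul, Pi.sub_apply,
      Finset.sum_apply, Pi.smul_apply, smul_eq_mul, Module.End.mul_apply, Module.End.one_apply,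
      ← sub_eq_add_neg]

end smoothPeriodic

/-- `Q_m` is self-adjoint on smooth `L`-periodic functions:
`∫ (Q_m f) g = ∫ f (Q_m g)` over `[0,L]²`. -/
theorem stmt12 (L : ℝ) (hL : 0 < L) (m : ℕ) (hm : 1 ≤ m)
    (f g : ℝ × ℝ → ℝ) (hf : ContDiff ℝ (⊤ : ℕ∞) f) (hg : ContDiff ℝ (⊤ : ℕ∞) g)
    (hfp : IsPeriodic L f) (hgp : IsPeriodic L g) :
    ∫ p in Set.Icc (0 : ℝ) L ×ˢ Set.Icc (0 : ℝ) L, Q m f p * g p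
      = ∫ p in Set.Icc (0 : ℝ) L ×ˢ Set.Icc (0 : ℝ) L, f p * Q m g p := by
  obtain ⟨T, hT, hTQ⟩ := smoothPeriodic.exists_mem_evenOps_eq_Q L m
  have h := smoothPeriodic.isAdjointPair_of_mem_evenOps hL.le hT ⟨f, hf, hfp⟩ ⟨g, hg, hgp⟩
  simpa only [smoothPeriodic.l2Form_apply, hTQ] using h
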